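/- In a trim lattice L with left modular labelling γ, if y ≤ m_1 (i.e., y ∈ L_1), then y ∨ j_1 covers y and the downward label set satisfies D^γ(y ∨ j_1) = D^γ(y) ∪ {1}. -/

import Mathlib

/-- An element `x` of a lattice is *left modular* if `(y ⊔ x) ⊓ z = y ⊔ (x ⊓ z)`
for all `y ≤ z`. -/
def LeftModular {L : Type*} [Lattice L] (x : L) : Prop :=
  ∀ y z : L, y ≤ z → (y ⊔ x) ⊓ z = y ⊔ (x ⊓ z)

/-- The data of an extremal lattice of length `n` together with a fixed
maximal-length chain `x₀ ⋖ ⋯ ⋖ xₙ` and the induced numberings of the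
join-irreducibles `j₁, …, jₙ` and meet-irreducibles `m₁, …, mₙ`. -/
structure ExtremalChainData (L : Type*) [Lattice L] [Fintype L] [BoundedOrder L]
    (n : ℕ) where
  x : Fin (n + 1) → L
  x_strictMono : StrictMono x
  x_bot : x 0 = ⊥
  x_top : x (Fin.last n) = ⊤
  maxlen : ∀ (m : ℕ) (c : Fin (m + 1) → L), StrictMono c → m ≤ n
  j : Fin n → L
  m : Fin n → L
  j_irr : ∀ i, SupIrred (j i)
  m_irr : ∀ i, InfIrred (m i)
  j_inj : Function.Injective j
  m_inj : Function.Injective m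
  j_surj : ∀ a : L, SupIrred a → a ∈ Set.range j
  m_surj : ∀ a : L, InfIrred a → a ∈ Set.range m
  x_eq_sup : ∀ i : Fin (n + 1),
    x i = (Finset.univ.filter fun k : Fin n => (k : ℕ) < (i : ℕ)).sup j
  x_eq_inf : ∀ i : Fin (n + 1),
    x i = (Finset.univ.filter fun k : Fin n => (i : ℕ) ≤ (k : ℕ)).inf m

namespace ExtremalChainData

variable {L : Type*} [Lattice L] [Fintype L] [BoundedOrder L] {n : ℕ}

/-- `x_J`: the set of indices of join-irreducibles lying below `a`. -/
def setJ (D : ExtremalChainData L n) (a : L) : Set (Fin n) := {i | D.j i ≤ a}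

/-- `x_M`: the set of indices of meet-irreducibles lying above `a`. -/
def setM (D : ExtremalChainData L n) (a : L) : Set (Fin n) := {i | a ≤ D.m i}

/-- The Galois graph: a directed edge `i → k` when `jᵢ ≰ m_k` and `i ≠ k`. -/
def galoisEdge (D : ExtremalChainData L n) (i k : Fin n) : Prop :=
  ¬ D.j i ≤ D.m k ∧ i ≠ k

/-- The left modular labelling: `i` is the label of the cover `y ⋖ z` iff `i` is
minimal with `y ⊔ (xᵢ ⊓ z) = z`. -/
def IsLabel (D : ExtremalChainData L n) (y z : L) (i : Fin n) : Prop :=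
  y ⊔ (D.x i.succ ⊓ z) = z ∧ ∀ k : Fin n, y ⊔ (D.x k.succ ⊓ z) = z → i ≤ k

open scoped Classical in
/-- `D^γ(a)`: the set of labels of cover relations below `a`. -/
noncomputable def downLabels (D : ExtremalChainData L n) (a : L) : Finset (Fin n) :=
  Finset.univ.filter fun i => ∃ y, y ⋖ a ∧ D.IsLabel y a i

open scoped Classical in
/-- `U^γ(a)`: the set of labels of cover relations above `a`. -/
noncomputable def upLabels (D : ExtremalChainData L n) (a : L) : Finset (Fin n) :=
  Finset.univ.filter fun i => ∃ z, a ⋖ z ∧ D.IsLabel a z i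

/-- The fixed chain consists of left modular elements, i.e. the lattice is trim. -/
def IsTrim (D : ExtremalChainData L n) : Prop := ∀ i, LeftModular (D.x i)

end ExtremalChainData

open ExtremalChainData

namespace ExtremalChainData

variable {L : Type*} [Lattice L] [Fintype L] [BoundedOrder L] {n : ℕ}
  (D : ExtremalChainData L n)

lemma j_le_x {k : Fin n} {t : Fin (n + 1)} (h : k.castSucc < t) : D.j k ≤ D.x t := by
  rw [D.x_eq_sup]
  exact Finset.le_sup (f := D.j) (by simpa [Fin.lt_def] using h)

lemma x_le_m {k : Fin n} {t : Fin (n + 1)} (h : t ≤ k.castSucc) : D.x t ≤ D.m k := by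
  rw [D.x_eq_inf]
  exact Finset.inf_le (f := D.m) (by simpa [Fin.le_def] using h)

lemma x_succ_le {i : Fin n} {a : L} (hx : D.x i.castSucc ≤ a) (hj : D.j i ≤ a) :
    D.x i.succ ≤ a := by
  rw [D.x_eq_sup]
  refine Finset.sup_le fun k hk => ?_
  rcases eq_or_ne k i with rfl | hne
  · exact hj
  · refine (D.j_le_x ?_).trans hx
    simp only [Finset.mem_filter, Fin.val_succ] at hk
    simp only [Fin.lt_def, Fin.val_castSucc]
    have := Fin.val_ne_of_ne hne
    omega

lemma x_succ_inf_m_le (i : Fin n) : D.x i.succ ⊓ D.m i ≤ D.x i.castSucc := by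
  rw [D.x_eq_inf i.castSucc]
  refine Finset.le_inf fun k hk => ?_
  rcases eq_or_ne k i with rfl | hne
  · exact inf_le_right
  · refine inf_le_left.trans (D.x_le_m ?_)
    simp only [Finset.mem_filter, Fin.val_castSucc] at hk
    simp only [Fin.le_def, Fin.val_castSucc, Fin.val_succ]
    have := Fin.val_ne_of_ne hne
    omega

lemma not_x_succ_le_castSucc (i : Fin n) : ¬ D.x i.succ ≤ D.x i.castSucc :=
  not_le_of_gt (D.x_strictMono Fin.castSucc_lt_succ)

lemma not_j_le_m (i : Fin n) : ¬ D.j i ≤ D.m i := fun h =>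
  D.not_x_succ_le_castSucc i <|
    (le_inf le_rfl (D.x_succ_le (D.x_le_m le_rfl) h)).trans (D.x_succ_inf_m_le i)

lemma lt_of_j_le_x {k : Fin n} {t : Fin (n + 1)} (h : D.j k ≤ D.x t) : k.castSucc < t := by
  by_contra! hlt
  exact D.not_j_le_m k (h.trans (D.x_le_m hlt))

lemma exists_j_le_not_le {a b : L} (h : ¬ a ≤ b) : ∃ k, D.j k ≤ a ∧ ¬ D.j k ≤ b := by
  obtain ⟨s, rfl, hs⟩ := exists_supIrred_decomposition a
  by_contra! hc
  refine h (Finset.sup_le fun p hp => ?_)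
  obtain ⟨k, rfl⟩ := D.j_surj p (hs hp)
  exact hc k (Finset.le_sup (f := id) hp)

lemma exists_le_m_not_le {a b : L} (h : ¬ b ≤ a) : ∃ k, a ≤ D.m k ∧ ¬ b ≤ D.m k := by
  obtain ⟨s, rfl, hs⟩ := exists_infIrred_decomposition a
  by_contra! hc
  refine h (Finset.le_inf fun p hp => ?_)
  obtain ⟨k, rfl⟩ := D.m_surj p (hs hp)
  exact hc k (Finset.inf_le (f := id) hp)

/-- The interval `[xᵢ₋₁, ⊤]` is the union of `[xᵢ₋₁, mᵢ]` and `[xᵢ, ⊤]`. -/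
lemma le_m_of_not_j_le {i : Fin n} {a : L} (hx : D.x i.castSucc ≤ a) (hj : ¬ D.j i ≤ a) :
    a ≤ D.m i := by
  obtain ⟨k, hak, hjk⟩ := D.exists_le_m_not_le hj
  rcases lt_trichotomy k i with h | rfl | h
  · exact absurd (((D.j_le_x (by simpa using h)).trans hx).trans hak) (D.not_j_le_m k)
  · exact hak
  · exact absurd ((D.j_le_x Fin.castSucc_lt_succ).trans
      (D.x_le_m (Fin.succ_le_castSucc_iff.2 h))) hjk

lemma isLabel_of_not_le {u v : L} (h : u ⋖ v) {i : Fin n} (hi : D.x i.castSucc ⊓ v ≤ u)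
    (hi' : ¬ D.x i.succ ⊓ v ≤ u) : D.IsLabel u v i := by
  refine ⟨?_, fun k hk => ?_⟩
  · exact (h.eq_or_eq le_sup_left (sup_le h.le inf_le_right)).resolve_left
      fun e => hi' (sup_eq_left.1 e)
  · by_contra! hlt
    have hle : D.x k.succ ⊓ v ≤ u :=
      (inf_le_inf_right v (D.x_strictMono.monotone (Fin.succ_le_castSucc_iff.2 hlt))).trans hi
    exact h.ne ((sup_eq_left.2 hle).symm.trans hk)

lemma exists_inf_le_not_le {u v : L} (h : u ⋖ v) :
    ∃ i : Fin n, D.x i.castSucc ⊓ v ≤ u ∧ ¬ D.x i.succ ⊓ v ≤ u := by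
  by_contra! hc
  have key : ∀ t, D.x t ⊓ v ≤ u := fun t => by
    induction t using Fin.induction with
    | zero => simp [D.x_bot]
    | succ i ih => exact hc i ih
  have := key (Fin.last n)
  rw [D.x_top, top_inf_eq] at this
  exact h.lt.not_ge this

lemma isLabel_iff {u v : L} (h : u ⋖ v) {i : Fin n} :
    D.IsLabel u v i ↔ D.x i.castSucc ⊓ v ≤ u ∧ ¬ D.x i.succ ⊓ v ≤ u := by
  refine ⟨fun hl => ?_, fun hl => D.isLabel_of_not_le h hl.1 hl.2⟩
  obtain ⟨k, hk⟩ := D.exists_inf_le_not_le h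
  have hl' := D.isLabel_of_not_le h hk.1 hk.2
  rwa [le_antisymm (hl.2 k hl'.1) (hl'.2 i hl.1)]

lemma IsLabel.j_le {D : ExtremalChainData L n} {u v : L} (h : u ⋖ v) {i : Fin n}
    (hi : D.IsLabel u v i) : D.j i ≤ v ∧ ¬ D.j i ≤ u := by
  obtain ⟨h1, h2⟩ := (D.isLabel_iff h).1 hi
  obtain ⟨k, hk, hku⟩ := D.exists_j_le_not_le h2
  obtain ⟨hkx, hkv⟩ := le_inf_iff.1 hk
  have hki : k ≤ i := by simpa [Fin.castSucc_lt_succ_iff] using D.lt_of_j_le_x hkx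
  rcases hki.lt_or_eq with hlt | rfl
  · exact absurd ((le_inf (D.j_le_x (by simpa using hlt)) hkv).trans h1) hku
  · exact ⟨hkv, hku⟩

lemma IsLabel.le_castSucc_iff {D : ExtremalChainData L n} {u v : L} (h : u ⋖ v) {i : Fin n}
    (hi : D.IsLabel u v i) {t : Fin (n + 1)} (ht : D.x t ≤ v) :
    t ≤ i.castSucc ↔ D.x t ≤ u := by
  refine ⟨fun hti => ?_, fun htu => ?_⟩
  · exact (le_inf (D.x_strictMono.monotone hti) ht).trans ((D.isLabel_iff h).1 hi).1
  · by_contra! hlt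
    exact (hi.j_le h).2 ((D.j_le_x hlt).trans htu)

lemma mem_downLabels {a : L} {i : Fin n} :
    i ∈ D.downLabels a ↔ ∃ u, u ⋖ a ∧ D.IsLabel u a i := by
  simp [downLabels]

/-- The downward labels of `a` inside the interval `[x_t, ⊤]`. -/
def downLabelsFrom (t : Fin (n + 1)) (a : L) : Set (Fin n) :=
  {i | i ∈ D.downLabels a ∧ t ≤ i.castSucc}

/-- Independence in the Galois graph. -/
def Independent (I : Set (Fin n)) : Prop := ∀ i ∈ I, ∀ k ∈ I, ¬ D.galoisEdge i k

lemma j_le_of_mem_downLabels {a : L} {i : Fin n} (h : i ∈ D.downLabels a) : D.j i ≤ a := by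
  obtain ⟨u, hu, hi⟩ := D.mem_downLabels.1 h
  exact (hi.j_le hu).1

/-- An element of `[x_t, ⊤]` is the join of `x_t` and the join-irreducibles indexed by its
downward labels. -/
lemma le_of_forall_downLabelsFrom {t : Fin (n + 1)} {v b : L} (hv : D.x t ≤ v)
    (hb : D.x t ≤ b) (h : ∀ i ∈ D.downLabelsFrom t v, D.j i ≤ b) : v ≤ b := by
  by_contra hvb
  obtain ⟨u, hbu, huv⟩ := exists_le_covBy_of_lt (inf_lt_right.2 hvb)
  obtain ⟨i, hi⟩ := D.exists_inf_le_not_le huv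
  have hl := (D.isLabel_iff huv).2 hi
  have hit := (hl.le_castSucc_iff huv hv).2 ((le_inf hb hv).trans hbu)
  have hjb := h i ⟨D.mem_downLabels.2 ⟨u, huv, hl⟩, hit⟩
  exact (hl.j_le huv).2 ((le_inf hjb (hl.j_le huv).1).trans hbu)

section Trim

variable {D}

lemma covBy_sup_x_succ (hD : D.IsTrim) {i : Fin n} {y : L} (hx : D.x i.castSucc ≤ y)
    (hy : y ≤ D.m i) : y ⋖ y ⊔ D.x i.succ ∧ D.IsLabel y (y ⊔ D.x i.succ) i := by
  have hj : D.j i ≤ D.x i.succ := D.j_le_x Fin.castSucc_lt_succ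
  have hjy : ¬ D.j i ≤ y := fun h => D.not_j_le_m i (h.trans hy)
  have hcov : y ⋖ y ⊔ D.x i.succ := by
    refine ⟨left_lt_sup.2 fun h => hjy (hj.trans h), fun z hyz hzv => ?_⟩
    by_cases hjz : D.j i ≤ z
    · exact hzv.not_ge (sup_le hyz.le (D.x_succ_le (hx.trans hyz.le) hjz))
    · have hz := D.le_m_of_not_j_le (hx.trans hyz.le) hjz
      have hle : D.x i.succ ⊓ z ≤ y :=
        ((inf_le_inf_left _ hz).trans (D.x_succ_inf_m_le i)).trans hx
      have := hD i.succ y z hyz.le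
      rw [inf_eq_right.2 hzv.le, sup_eq_left.2 hle] at this
      exact hyz.ne this.symm
  exact ⟨hcov, D.isLabel_of_not_le hcov (inf_le_left.trans hx)
    fun h => hjy ((le_inf hj (hj.trans le_sup_right)).trans h)⟩

lemma downLabelsFrom_subset_sup (hD : D.IsTrim) {t : Fin n} {y : L}
    (hy : y ≤ D.m t) :
    D.downLabelsFrom t.castSucc y ⊆ D.downLabelsFrom t.succ (y ⊔ D.x t.succ) := by
  rintro i ⟨hi, hti⟩
  obtain ⟨w, hw, hl⟩ := D.mem_downLabels.1 hi
  have hne : t ≠ i := by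
    rintro rfl
    exact D.not_j_le_m t ((hl.j_le hw).1.trans hy)
  have hti' : t.succ ≤ i.castSucc :=
    Fin.succ_le_castSucc_iff.2 (lt_of_le_of_ne (by simpa using hti) hne)
  have hxX := D.x_strictMono.monotone hti'
  set v := y ⊔ D.x t.succ
  obtain ⟨hl1, -⟩ := (D.isLabel_iff hw).1 hl
  have hxS : D.x t.succ ≤ w ⊔ (D.x i.castSucc ⊓ v) :=
    (le_inf hxX le_sup_right).trans le_sup_right
  have hyS : ¬ y ≤ w ⊔ (D.x i.castSucc ⊓ v) := by
    intro h
    rw [← hD i.castSucc w v (hw.le.trans le_sup_left)] at h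
    have := hD i.castSucc w y hw.le
    rw [inf_eq_right.2 (h.trans inf_le_left), sup_eq_left.2 hl1] at this
    exact hw.ne this.symm
  have hSv : w ⊔ (D.x i.castSucc ⊓ v) < v :=
    lt_of_le_of_ne (sup_le (hw.le.trans le_sup_left) inf_le_right)
      fun e => hyS (le_sup_left.trans e.ge)
  obtain ⟨u, hSu, huv⟩ := exists_le_covBy_of_lt hSv
  refine ⟨D.mem_downLabels.2 ⟨u, huv, D.isLabel_of_not_le huv (le_sup_right.trans hSu)
    fun h => ?_⟩, hti'⟩
  have hyu : y ≤ u := by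
    rw [← hl.1]
    exact sup_le (le_sup_left.trans hSu) ((inf_le_inf_left _ le_sup_left).trans h)
  exact huv.lt.not_ge (sup_le hyu (hxS.trans hSu))

lemma downLabelsFrom_sup_x_succ (hD : D.IsTrim) {t : Fin n}
    (hind : ∀ v, D.x t.succ ≤ v → D.Independent (D.downLabelsFrom t.succ v))
    (hex : ∀ I : Set (Fin n), D.Independent I → (∀ i ∈ I, t.succ ≤ i.castSucc) →
      ∃ v, D.x t.succ ≤ v ∧ D.downLabelsFrom t.succ v = I)
    {y : L} (hx : D.x t.castSucc ≤ y) (hy : y ≤ D.m t) :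
    D.downLabelsFrom t.succ (y ⊔ D.x t.succ) = D.downLabelsFrom t.castSucc y := by
  have hsub := downLabelsFrom_subset_sup hD hy
  obtain ⟨v, hv, hvy⟩ := hex (D.downLabelsFrom t.castSucc y)
    (fun i hi k hk => hind _ le_sup_right i (hsub hi) k (hsub hk)) fun i hi => (hsub hi).2
  have hle : v ≤ y ⊔ D.x t.succ := D.le_of_forall_downLabelsFrom hv le_sup_right fun i hi =>
    (D.j_le_of_mem_downLabels (hvy ▸ hi).1).trans le_sup_left
  have hyv : y ≤ v := D.le_of_forall_downLabelsFrom hx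
    ((D.x_strictMono.monotone Fin.castSucc_lt_succ.le).trans hv) fun i hi =>
      D.j_le_of_mem_downLabels (hvy.symm ▸ hi).1
  rw [← hvy, le_antisymm hle (sup_le hyv hv)]

lemma downLabelsFrom_castSucc_of_mem {t : Fin n} {v : L} (h : t ∈ D.downLabels v) :
    D.downLabelsFrom t.castSucc v = insert t (D.downLabelsFrom t.succ v) := by
  ext i
  simp only [downLabelsFrom, Set.mem_ofPred_eq, Set.mem_insert_iff, Fin.castSucc_le_castSucc_iff,
    Fin.succ_le_castSucc_iff]
  grind

lemma downLabelsFrom_castSucc_of_notMem {t : Fin n} {v : L} (h : t ∉ D.downLabels v) :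
    D.downLabelsFrom t.castSucc v = D.downLabelsFrom t.succ v := by
  ext i
  simp only [downLabelsFrom, Set.mem_ofPred_eq, Fin.castSucc_le_castSucc_iff,
    Fin.succ_le_castSucc_iff]
  grind

lemma exists_eq_sup_of_mem_downLabels {t : Fin n} {v : L} (hv : D.x t.succ ≤ v)
    (h : t ∈ D.downLabels v) :
    ∃ y, D.x t.castSucc ≤ y ∧ y ≤ D.m t ∧ y ⊔ D.x t.succ = v := by
  obtain ⟨y, hyv, hl⟩ := D.mem_downLabels.1 h
  have hx := (hl.le_castSucc_iff hyv
    ((D.x_strictMono.monotone Fin.castSucc_lt_succ.le).trans hv)).1 le_rfl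
  have hj := (hl.j_le hyv).2
  refine ⟨y, hx, D.le_m_of_not_j_le hx hj, ?_⟩
  exact (hyv.eq_or_eq le_sup_left (sup_le hyv.le hv)).resolve_left fun e =>
    hj ((D.j_le_x Fin.castSucc_lt_succ).trans (sup_eq_left.1 e))

/-- In a trim lattice, the downward labels in each interval `[x_t, ⊤]` form an independent set
of the Galois graph, and every independent set arises in this way. -/
theorem independent_downLabelsFrom (hD : D.IsTrim) (t : Fin (n + 1)) :
    (∀ v, D.x t ≤ v → D.Independent (D.downLabelsFrom t v)) ∧
      ∀ I : Set (Fin n), D.Independent I → (∀ i ∈ I, t ≤ i.castSucc) →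
        ∃ v, D.x t ≤ v ∧ D.downLabelsFrom t v = I := by
  induction t using Fin.reverseInduction with
  | last =>
    have hlast : ∀ i : Fin n, ¬ Fin.last n ≤ i.castSucc := fun i => by simp
    refine ⟨fun v _ i hi => absurd hi.2 (hlast i), fun I _ hI => ⟨⊤, le_top, ?_⟩⟩
    ext i
    exact ⟨fun hi => absurd hi.2 (hlast i), fun hi => absurd (hI i hi) (hlast i)⟩
  | cast t ih =>
    obtain ⟨hind, hex⟩ := ih
    have hmono : D.x t.castSucc ≤ D.x t.succ :=
      D.x_strictMono.monotone Fin.castSucc_lt_succ.le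
    have hsup : ∀ {y : L}, D.x t.castSucc ≤ y → y ≤ D.m t →
        D.downLabelsFrom t.succ (y ⊔ D.x t.succ) = D.downLabelsFrom t.castSucc y :=
      fun hx hy => downLabelsFrom_sup_x_succ hD hind hex hx hy
    refine ⟨fun v hv => ?_, fun I hI hIt => ?_⟩
    · by_cases hj : D.j t ≤ v
      · have hxv := D.x_succ_le hv hj
        by_cases ht : t ∈ D.downLabels v
        · obtain ⟨y, hxy, hym, rfl⟩ := exists_eq_sup_of_mem_downLabels hxv ht
          rw [downLabelsFrom_castSucc_of_mem ht]
          have hlab := hsup hxy hym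
          rintro i (rfl | hi) k (rfl | hk)
          · exact fun e => e.2 rfl
          · exact fun e => e.1 ((D.j_le_x Fin.castSucc_lt_succ).trans (D.x_le_m hk.2))
          · exact fun e => e.1 ((D.j_le_of_mem_downLabels (hlab ▸ hi).1).trans hym)
          · exact hind _ hxv i hi k hk
        · rw [downLabelsFrom_castSucc_of_notMem ht]
          exact hind v hxv
      · rw [← hsup hv (D.le_m_of_not_j_le hv hj)]
        exact hind _ le_sup_right
    · by_cases ht : t ∈ I
      · obtain ⟨v, hv, hvI⟩ := hex (I \ {t}) (fun i hi k hk => hI i hi.1 k hk.1)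
          fun i hi => Fin.succ_le_castSucc_iff.2
            (lt_of_le_of_ne (by simpa using hIt i hi.1) (Ne.symm hi.2))
        have hxy : D.x t.castSucc ≤ v ⊓ D.m t := le_inf (hmono.trans hv) (D.x_le_m le_rfl)
        have hveq : v ⊓ D.m t ⊔ D.x t.succ = v := by
          refine le_antisymm (sup_le inf_le_left hv) ?_
          refine D.le_of_forall_downLabelsFrom hv le_sup_right fun i hi => ?_
          have hiI : i ∈ I \ {t} := hvI ▸ hi
          have hjm : D.j i ≤ D.m t := by
            by_contra h
            exact hI i hiI.1 t ht ⟨h, hiI.2⟩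
          exact (le_inf (D.j_le_of_mem_downLabels hi.1) hjm).trans le_sup_left
        have htv : t ∈ D.downLabels v := by
          have := covBy_sup_x_succ hD hxy inf_le_right
          rw [hveq] at this
          exact D.mem_downLabels.2 ⟨_, this⟩
        refine ⟨v, hmono.trans hv, ?_⟩
        rw [downLabelsFrom_castSucc_of_mem htv, hvI, Set.insert_sdiff_singleton,
          Set.insert_eq_of_mem ht]
      · obtain ⟨v, hv, hvI⟩ := hex I hI fun i hi => Fin.succ_le_castSucc_iff.2
          (lt_of_le_of_ne (by simpa using hIt i hi) fun e => ht (e ▸ hi))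
        by_cases htv : t ∈ D.downLabels v
        · obtain ⟨y, hxy, hym, rfl⟩ := exists_eq_sup_of_mem_downLabels hv htv
          exact ⟨y, hxy, (hsup hxy hym).symm.trans hvI⟩
        · exact ⟨v, hmono.trans hv, (downLabelsFrom_castSucc_of_notMem htv).trans hvI⟩

end Trim

end ExtremalChainData

/-- In a trim lattice, if `y ∈ L₁ = [⊥, m₁]` then `y ∨ j₁` covers `y` and
`D^γ(y ∨ j₁) = D^γ(y) ∪ {1}`. -/
theorem down_labels_join_j1 {L : Type*} [Lattice L] [Fintype L] [BoundedOrder L]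
    {n : ℕ} (D : ExtremalChainData L n) (hD : D.IsTrim) (hn : 0 < n) :
    ∀ y : L, y ≤ D.m ⟨0, hn⟩ →
      y ⋖ y ⊔ D.j ⟨0, hn⟩ ∧
      D.downLabels (y ⊔ D.j ⟨0, hn⟩) = insert ⟨0, hn⟩ (D.downLabels y) := by
  intro y hy
  set i : Fin n := ⟨0, hn⟩ with hi
  have hcast : D.x i.castSucc = ⊥ := D.x_bot
  have hbot : D.x i.castSucc ≤ y := hcast ▸ bot_le
  have hxj : D.x i.succ = D.j i :=
    le_antisymm (D.x_succ_le (hcast ▸ bot_le) le_rfl) (D.j_le_x Fin.castSucc_lt_succ)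
  obtain ⟨hcov, hl⟩ := covBy_sup_x_succ hD hbot hy
  obtain ⟨hind, hex⟩ := independent_downLabelsFrom hD i.succ
  have hlab := downLabelsFrom_sup_x_succ hD hind hex hbot hy
  have hins := downLabelsFrom_castSucc_of_mem (D.mem_downLabels.2 ⟨y, hcov, hl⟩)
  rw [hlab] at hins
  have hall : ∀ a : L, D.downLabelsFrom i.castSucc a = D.downLabels a := fun a => by
    ext k
    simp [downLabelsFrom, hi]
  rw [hall, hall] at hins
  rw [← hxj]
  exact ⟨hcov, by exact_mod_cast hins⟩
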